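/- arXiv:1002.1763 — 4 statements merged into one kernel-verified Lean document; each statement's English description precedes it below -/
import Mathlib

section
/- (The Diagonal Formula) For every real q with 0 < q < 1/2, the natural number ⌈ q/(1−2q) ⌉ is the least element of the set { n : ℕ | for all m, f(m, 1−q, q) ≤ f(n, 1−q, q) }; that is, ⌈ q/(1−2q) ⌉ maximizes n ↦ f(n, 1−q, q) and is the smallest maximizer. -/
/-- `f n p q` is the probability that in `n` independent tosses each, a coin with heads
probability `q` produces strictly more heads than a coin with heads probability `p`. -/
noncomputable def f (n : ℕ) (p q : ℝ) : ℝ :=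
  ∑ r ∈ Finset.range (n + 1), ∑ s ∈ Finset.Icc (r + 1) n,
    (n.choose r : ℝ) * p ^ r * (1 - p) ^ (n - r) *
      ((n.choose s : ℝ) * q ^ s * (1 - q) ^ (n - s))

noncomputable def bb (q : ℝ) (n k : ℕ) : ℝ := (n.choose k : ℝ) * q ^ k * (1 - q) ^ (n - k)

noncomputable def LL (q : ℝ) (n j : ℕ) : ℝ := ∑ k ∈ Finset.range j, bb q n k

lemma bb_zero (q : ℝ) (n : ℕ) : bb q n 0 = (1 - q) ^ n := by simp [bb]

lemma bb_succ (q : ℝ) (n k : ℕ) :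
    bb q (n + 1) (k + 1) = q * bb q n k + (1 - q) * bb q n (k + 1) := by
  unfold bb
  rw [Nat.choose_succ_succ, Nat.add_sub_add_right]
  push_cast
  rcases Nat.lt_or_ge k n with h | h
  · obtain ⟨d, rfl⟩ := Nat.exists_eq_add_of_lt h
    have e1 : k + d + 1 - k = d + 1 := by omega
    have e2 : k + d + 1 - (k + 1) = d := by omega
    rw [e1, e2]
    ring
  · have : n.choose (k + 1) = 0 := Nat.choose_eq_zero_of_lt (by omega)
    rw [this]
    push_cast
    ring

lemma LL_succ (q : ℝ) (n j : ℕ) : LL q (n + 1) (j + 1) = LL q n (j + 1) - q * bb q n j := by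
  induction j with
  | zero => simp [LL, bb_zero]; ring
  | succ j ih =>
    have h1 : LL q (n + 1) (j + 1 + 1) = LL q (n + 1) (j + 1) + bb q (n + 1) (j + 1) :=
      Finset.sum_range_succ _ _
    have h2 : LL q n (j + 1 + 1) = LL q n (j + 1) + bb q n (j + 1) :=
      Finset.sum_range_succ _ _
    rw [h1, h2, ih, bb_succ]
    ring

lemma LL_full (q : ℝ) (n : ℕ) : LL q n (n + 1) = 1 := by
  have h := add_pow q (1 - q) n
  rw [add_sub_cancel, one_pow] at h
  rw [h]
  unfold LL bb
  exact Finset.sum_congr rfl fun k _ => by ring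

lemma bb_conv (q : ℝ) (n k : ℕ) :
    ∑ r ∈ Finset.range (k + 1), bb q n r * bb q n (k - r) = bb q (n + n) k := by
  unfold bb
  rw [Nat.add_choose_eq, Finset.Nat.sum_antidiagonal_eq_sum_range_succ_mk]
  push_cast
  rw [Finset.sum_mul, Finset.sum_mul]
  refine Finset.sum_congr rfl fun r hr => ?_
  have hr' : r ≤ k := by simpa [Nat.lt_succ_iff] using hr
  rcases Nat.lt_or_ge n r with h | h
  · simp [Nat.choose_eq_zero_of_lt h]
  rcases Nat.lt_or_ge n (k - r) with h2 | h2
  · simp [Nat.choose_eq_zero_of_lt h2]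
  have e1 : n + n - k = (n - r) + (n - (k - r)) := by omega
  have e2 : q ^ k = q ^ r * q ^ (k - r) := by rw [← pow_add]; congr 1; omega
  rw [e1, pow_add, e2]
  ring

lemma f_eq (q : ℝ) (n : ℕ) : f n (1 - q) q = 1 - LL q (n + n) (n + 1) := by
  have h1 : f n (1 - q) q = ∑ r ∈ Finset.range (n + 1),
      bb q n r * (1 - ∑ s ∈ Finset.range (n + 1 - r), bb q n s) := by
    rw [← Finset.sum_flip]
    unfold f
    refine Finset.sum_congr rfl fun r hr => ?_
    have hr' : r ≤ n := by simpa [Nat.lt_succ_iff] using hr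
    have e : n + 1 - (n - r) = r + 1 := by omega
    have e2 : n - (n - r) = r := by omega
    rw [e]
    have h3 : LL q n (n + 1) = ∑ s ∈ Finset.range (r + 1), bb q n s
        + ∑ s ∈ Finset.Ico (r + 1) (n + 1), bb q n s :=
      (Finset.sum_range_add_sum_Ico _ (by omega)).symm
    rw [LL_full] at h3
    have h4 : 1 - ∑ s ∈ Finset.range (r + 1), bb q n s = ∑ s ∈ Finset.Ico (r + 1) (n + 1), bb q n s := by linarith
    rw [h4, Finset.mul_sum]
    refine Finset.sum_congr (by ext; simp only [Finset.mem_Icc, Finset.mem_Ico]; omega) fun s _ => ?_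
    unfold bb
    rw [e2, Nat.choose_symm hr', sub_sub_cancel]
    ring
  have h2 := Finset.sum_range_diag_flip (n + 1) (fun r s => bb q n r * bb q n s)
  simp only [bb_conv] at h2
  rw [h1]
  simp only [mul_sub, mul_one, Finset.sum_sub_distrib, Finset.mul_sum]
  rw [← h2]
  have := LL_full q n
  unfold LL at this ⊢
  rw [this]

lemma f_step (q : ℝ) (n : ℕ) : ((n : ℝ) + 1) * (f (n + 1) (1 - q) q - f n (1 - q) q)
    = (q ^ (n + 1) * (1 - q) ^ n * ((n + n).choose n : ℝ)) * (q - n * (1 - 2 * q)) := by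
  rw [f_eq, f_eq]
  have e : n + 1 + (n + 1) = (n + n + 1) + 1 := by omega
  have h1 : LL q (n + n + 1) (n + 1 + 1) = LL q (n + n + 1) (n + 1) + bb q (n + n + 1) (n + 1) :=
    Finset.sum_range_succ _ _
  rw [e, LL_succ, h1, LL_succ, bb_succ]
  have h2 : ((n + n).choose (n + 1) : ℝ) * (n + 1) = ((n + n).choose n : ℝ) * n := by
    have := Nat.choose_succ_right_eq (n + n) n
    rw [Nat.add_sub_cancel] at this
    exact_mod_cast this
  have h3 : bb q (n + n) n = ((n + n).choose n : ℝ) * q ^ n * (1 - q) ^ n := by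
    unfold bb; rw [Nat.add_sub_cancel]
  have h4 : (1 - q) * bb q (n + n) (n + 1) * (n + 1)
      = ((n + n).choose n : ℝ) * n * q ^ (n + 1) * (1 - q) ^ n := by
    unfold bb
    rw [← h2]
    rcases n with _ | n
    · simp
    · have : n + 1 + (n + 1) - (n + 1 + 1) = n := by omega
      rw [this]; ring
  rw [h3]
  linear_combination (-(1 - q)) * h4

theorem statement6 (q : ℝ) (hq : 0 < q) (hq2 : q < 1 / 2) :
    IsLeast {n : ℕ | ∀ m : ℕ, f m (1 - q) q ≤ f n (1 - q) q}
      ⌈q / (1 - 2 * q)⌉₊ := by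
  have hd : 0 < 1 - 2 * q := by linarith
  have hC : ∀ n : ℕ, 0 < q ^ (n + 1) * (1 - q) ^ n * ((n + n).choose n : ℝ) := fun n => by
    have h1 : 0 < 1 - q := by linarith
    have h2 : (0 : ℝ) < ((n + n).choose n : ℝ) := by
      exact_mod_cast Nat.choose_pos (by omega)
    positivity
  have up : ∀ n : ℕ, n < ⌈q / (1 - 2 * q)⌉₊ → f n (1 - q) q < f (n + 1) (1 - q) q := by
    intro n hn
    rw [Nat.lt_ceil, lt_div_iff₀ hd] at hn
    have h := f_step q n
    have h5 := mul_pos (hC n) (sub_pos.2 hn)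
    rw [← h] at h5
    have := pos_of_mul_pos_right h5 (by positivity)
    linarith
  have down : ∀ n : ℕ, ⌈q / (1 - 2 * q)⌉₊ ≤ n → f (n + 1) (1 - q) q ≤ f n (1 - q) q := by
    intro n hn
    rw [Nat.ceil_le, div_le_iff₀ hd] at hn
    have h := f_step q n
    have h5 := mul_nonpos_of_nonneg_of_nonpos (hC n).le (sub_nonpos.2 hn)
    rw [← h] at h5
    by_contra hc
    have : 0 < ((n : ℝ) + 1) * (f (n + 1) (1 - q) q - f n (1 - q) q) :=
      mul_pos (by positivity) (by linarith)
    linarith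
  generalize ⌈q / (1 - 2 * q)⌉₊ = c at up down
  have lt : ∀ d n : ℕ, n + d + 1 = c → f n (1 - q) q < f c (1 - q) q := by
    intro d
    induction d with
    | zero => intro n hn; subst hn; exact up n (by omega)
    | succ d ih => intro n hn; exact (up n (by omega)).trans (ih (n + 1) (by omega))
  refine ⟨fun m => ?_, fun m hm => ?_⟩
  · rcases Nat.lt_or_ge m c with h | h
    · exact (lt (c - m - 1) m (by omega)).le
    · induction m, h using Nat.le_induction with
      | base => exact le_rfl
      | succ m h ih => exact (down m h).trans ih
  · by_contra h
    exact absurd (hm c) (not_le.2 (lt (c - m - 1) m (by omega)))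
end

section
/- (Lower bounds on the optimal length) Let 0 < q < p < 1 and let n be a natural number such that f(m, p, q) ≤ f(n, p, q) for all natural numbers m. Then n ≥ ⌊ 1/(2(p−q)) − 1/2 ⌋; moreover, if p + q ≠ 1, then n ≥ ⌊ 1/(2(p−q)) + 1/2 ⌋. -/
lemma core_step (c g A u : ℝ) (n : ℝ) (hn : 0 ≤ n) (hc : 0 < c) (hg : 0 < g)
    (hA : 0 < A) (hu : 0 ≤ u) (K : 2 * (n + 1) * u ^ 2 + c * u * A ≤ 2 * n * g * A ^ 2)
    (u' : ℝ) (hu' : (n + 2) * u' = (n + 1) * (c * u + 2 * g * A)) :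
    (4 * g ≤ c ^ 2 → 2 * (n + 2) * u' ^ 2 + c * u' * (c * A + 2 * u)
      ≤ 2 * (n + 1) * g * (c * A + 2 * u) ^ 2) ∧
    (4 * g < c ^ 2 → 2 * (n + 2) * u' ^ 2 + c * u' * (c * A + 2 * u)
      < 2 * (n + 1) * g * (c * A + 2 * u) ^ 2) := by
  have hcuA : 0 ≤ c * u * A := by positivity
  have hgA : 0 < g * A ^ 2 := by positivity
  have hv : u ^ 2 < g * A ^ 2 := by
    by_contra h
    push Not at h
    nlinarith [mul_le_mul_of_nonneg_left h hn]
  have hS : 0 < 2 * (n + 1) * g * A ^ 2 - (2 * (n + 2) * u ^ 2 + c * u * A) := by nlinarith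
  have hue : u' = (n + 1) * (c * u + 2 * g * A) / (n + 2) := by
    field_simp; linarith
  have key : 2 * (n + 1) * g * (c * A + 2 * u) ^ 2 -
      (2 * (n + 2) * u' ^ 2 + c * u' * (c * A + 2 * u)) =
      (n + 1) / (n + 2) * ((c ^ 2 - 4 * g) *
        (2 * (n + 1) * g * A ^ 2 - (2 * (n + 2) * u ^ 2 + c * u * A))) := by
    rw [hue]; field_simp; ring
  have hr : 0 < (n + 1) / (n + 2) := by positivity
  constructor
  · intro h
    have : 0 ≤ (n + 1) / (n + 2) * ((c ^ 2 - 4 * g) *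
        (2 * (n + 1) * g * A ^ 2 - (2 * (n + 2) * u ^ 2 + c * u * A))) :=
      mul_nonneg hr.le (mul_nonneg (by linarith) hS.le)
    linarith
  · intro h
    have : 0 < (n + 1) / (n + 2) * ((c ^ 2 - 4 * g) *
        (2 * (n + 1) * g * A ^ 2 - (2 * (n + 2) * u ^ 2 + c * u * A))) :=
      mul_pos hr (mul_pos (by linarith) hS)
    linarith

lemma core (c g : ℝ) (hc : 0 < c) (hg : 0 < g) (hcg : 4 * g ≤ c ^ 2) (A u : ℕ → ℝ)
    (hA0 : A 0 = 1) (hu0 : u 0 = 0) (hA : ∀ n, A (n + 1) = c * A n + 2 * u n)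
    (hu : ∀ n : ℕ, ((n : ℝ) + 2) * u (n + 1) = (n + 1) * (c * u n + 2 * g * A n)) (n : ℕ) :
    0 < A n ∧ 0 ≤ u n ∧
      2 * ((n : ℝ) + 1) * u n ^ 2 + c * u n * A n ≤ 2 * n * g * A n ^ 2 := by
  induction n with
  | zero => simp [hA0, hu0]
  | succ n ih =>
    obtain ⟨h1, h2, h3⟩ := ih
    refine ⟨by rw [hA]; positivity, ?_, ?_⟩
    · have : 0 ≤ ((n : ℝ) + 2) * u (n + 1) := by rw [hu]; positivity
      exact nonneg_of_mul_nonneg_right this (by positivity)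
    · have := (core_step c g (A n) (u n) n (by positivity) hc hg h1 h2 h3 _ (hu n)).1 hcg
      rw [hA]; push_cast
      linarith

lemma core_final (a b c : ℝ) (ha : 0 < a) (hb : 0 < b) (hc : 0 < c)
    (hcg : 4 * (a * b) ≤ c ^ 2) (habc : a + b + c = 1) (A u : ℕ → ℝ)
    (hA0 : A 0 = 1) (hu0 : u 0 = 0) (hA : ∀ n, A (n + 1) = c * A n + 2 * u n)
    (hu : ∀ n : ℕ, ((n : ℝ) + 2) * u (n + 1) = (n + 1) * (c * u n + 2 * (a * b) * A n)) (n : ℕ)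
    (hd : (2 * (n : ℝ) + 1) * (b - a) < 1 ∨
      (4 * (a * b) < c ^ 2 ∧ (2 * (n : ℝ) + 1) * (b - a) ≤ 1)) :
    u n < a * A n := by
  have hg : 0 < a * b := by positivity
  obtain ⟨h1, h2, h3⟩ := core c (a * b) hc hg hcg A u hA0 hu0 hA hu n
  by_contra hlt
  push Not at hlt
  have e1 : (a * A n) ^ 2 ≤ u n ^ 2 := by gcongr
  have e2 : c * (a * A n) * A n ≤ c * u n * A n := by gcongr
  have hn0 : (0 : ℝ) ≤ n := by positivity
  have e3 : 2 * ((n : ℝ) + 1) * (a * A n) ^ 2 ≤ 2 * ((n : ℝ) + 1) * u n ^ 2 := by gcongr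
  have id : 2 * ((n : ℝ) + 1) * (a * A n) ^ 2 + c * (a * A n) * A n - 2 * n * (a * b) * A n ^ 2
      = a * A n ^ 2 * (1 - (2 * (n : ℝ) + 1) * (b - a)) := by
    have : c = 1 - a - b := by linarith
    rw [this]; ring
  have hpos : 0 < a * A n ^ 2 := by positivity
  rcases hd with hd | ⟨hs, hd⟩
  · nlinarith [mul_pos hpos (sub_pos.2 hd)]
  · have h5 := mul_nonneg hpos.le (sub_nonneg.2 hd)
    cases n with
    | zero => rw [hA0, hu0] at hlt; linarith
    | succ m =>
      obtain ⟨g1, g2, g3⟩ := core c (a * b) hc hg hcg A u hA0 hu0 hA hu m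
      have := (core_step c (a * b) (A m) (u m) m (by positivity) hc hg g1 g2 g3 _ (hu m)).2 hs
      rw [← hA] at this
      push_cast at *
      linarith

/-- Binomial weight. -/
noncomputable def bw (n : ℕ) (p : ℝ) (r : ℕ) : ℝ := (n.choose r : ℝ) * p ^ r * (1 - p) ^ (n - r)

lemma bw_sum (n : ℕ) (p : ℝ) (ψ : ℕ → ℝ) :
    ∑ r ∈ Finset.range (n + 2), bw (n + 1) p r * ψ r =
      ∑ r ∈ Finset.range (n + 1), bw n p r * (p * ψ (r + 1) + (1 - p) * ψ r) := by
  have h0 : bw n p (n + 1) = 0 := by simp [bw]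
  have e : ∀ r ∈ Finset.range (n + 1), bw (n + 1) p (r + 1) =
      p * bw n p r + (1 - p) * bw n p (r + 1) := by
    intro r hr
    have hr : r ≤ n := by simpa [Nat.lt_succ_iff] using hr
    unfold bw
    rw [Nat.choose_succ_succ, Nat.add_sub_add_right]
    rcases hr.lt_or_eq with h | h
    · have : n - r = (n - (r + 1)) + 1 := by omega
      rw [this]; push_cast; ring
    · subst h; simp; ring
  have e0 : bw (n + 1) p 0 = (1 - p) * bw n p 0 := by
    simp [bw]; ring
  rw [Finset.sum_range_succ', Finset.sum_congr rfl (fun r hr => by rw [e r hr]), e0]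
  have s : ∑ r ∈ Finset.range (n + 1), bw n p r * ψ r =
      ∑ r ∈ Finset.range (n + 1), bw n p (r + 1) * ψ (r + 1) + bw n p 0 * ψ 0 := by
    rw [← Finset.sum_range_succ' (fun r => bw n p r * ψ r), Finset.sum_range_succ _ (n + 1), h0]; simp
  have l : ∑ r ∈ Finset.range (n + 1), bw n p r * (p * ψ (r + 1) + (1 - p) * ψ r) =
      p * ∑ r ∈ Finset.range (n + 1), bw n p r * ψ (r + 1) +
      (1 - p) * ∑ r ∈ Finset.range (n + 1), bw n p r * ψ r := by
    rw [Finset.mul_sum, Finset.mul_sum, ← Finset.sum_add_distrib]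
    exact Finset.sum_congr rfl (fun _ _ => by ring)
  rw [l, s, mul_add, Finset.mul_sum, Finset.mul_sum, ← add_assoc, ← Finset.sum_add_distrib]
  congr 1
  · exact Finset.sum_congr rfl (fun _ _ => by ring)
  · ring

/-- Expectation of a function of the difference. -/
noncomputable def EE (n : ℕ) (p q : ℝ) (φ : ℤ → ℝ) : ℝ :=
  ∑ r ∈ Finset.range (n + 1), bw n p r * ∑ s ∈ Finset.range (n + 1), bw n q s * φ ((s : ℤ) - r)

lemma EE_lin (n : ℕ) (p q x y z : ℝ) (φ χ ω : ℤ → ℝ) :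
    EE n p q (fun k => x * φ k + y * χ k + z * ω k) =
      x * EE n p q φ + y * EE n p q χ + z * EE n p q ω := by
  simp only [EE, Finset.mul_sum, ← Finset.sum_add_distrib]
  exact Finset.sum_congr rfl (fun _ _ => Finset.sum_congr rfl (fun _ _ => by ring))

lemma EE_succ (n : ℕ) (p q : ℝ) (φ : ℤ → ℝ) :
    EE (n + 1) p q φ = EE n p q (fun k => (q * (1 - p)) * φ (k + 1)
      + (p * q + (1 - p) * (1 - q)) * φ k + (p * (1 - q)) * φ (k - 1)) := by
  unfold EE
  rw [bw_sum n p (fun r => ∑ s ∈ Finset.range (n + 2), bw (n + 1) q s * φ ((s : ℤ) - r))]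
  refine Finset.sum_congr rfl (fun r _ => ?_)
  rw [bw_sum n q (fun s => φ ((s : ℤ) - r)), bw_sum n q (fun s => φ ((s : ℤ) - (r + 1 : ℕ))),
    Finset.mul_sum, Finset.mul_sum, ← Finset.sum_add_distrib]
  congr 1
  refine Finset.sum_congr rfl (fun s _ => ?_)
  have h1 : (((s + 1 : ℕ) : ℤ) - ((r + 1 : ℕ) : ℤ)) = (s : ℤ) - r := by push_cast; ring
  have h2 : ((s : ℤ) - ((r + 1 : ℕ) : ℤ)) = (s : ℤ) - r - 1 := by push_cast; ring
  have h3 : (((s + 1 : ℕ) : ℤ) - (r : ℤ)) = (s : ℤ) - r + 1 := by push_cast; ring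
  rw [h1, h2, h3]; ring

lemma f_eq_s8 (n : ℕ) (p q : ℝ) : f n p q = EE n p q (fun k => if 0 < k then 1 else 0) := by
  unfold f EE
  refine Finset.sum_congr rfl (fun r _ => ?_)
  rw [Finset.mul_sum]
  have : Finset.Icc (r + 1) n = (Finset.range (n + 1)).filter (fun s : ℕ => 0 < (s : ℤ) - r) := by
    ext s; simp; omega
  rw [this, Finset.sum_filter]
  refine Finset.sum_congr rfl (fun s _ => ?_)
  by_cases h : 0 < (s : ℤ) - r
  · simp only [h, if_true, bw]; ring
  · simp only [h, if_false, bw]; ring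

/-- Point mass of the difference. -/
noncomputable def ww (p q : ℝ) (n : ℕ) (k : ℤ) : ℝ := EE n p q (fun j => if j = k then 1 else 0)

lemma ww_zero (p q : ℝ) (k : ℤ) : ww p q 0 k = if k = 0 then 1 else 0 := by
  simp [ww, EE, bw, eq_comm]

lemma ww_succ (p q : ℝ) (n : ℕ) (k : ℤ) : ww p q (n + 1) k =
    (q * (1 - p)) * ww p q n (k - 1) + (p * q + (1 - p) * (1 - q)) * ww p q n k
      + (p * (1 - q)) * ww p q n (k + 1) := by
  unfold ww
  rw [EE_succ, ← EE_lin]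
  congr 1
  ext j
  simp only [← eq_sub_iff_add_eq, sub_eq_iff_eq_add]

lemma f_succ (n : ℕ) (p q : ℝ) : f (n + 1) p q - f n p q =
    q * (1 - p) * ww p q n 0 - p * (1 - q) * ww p q n 1 := by
  have h : f (n + 1) p q = 1 * f n p q + (q * (1 - p)) * ww p q n 0
      + (-(p * (1 - q))) * ww p q n 1 := by
    rw [f_eq_s8, f_eq_s8, EE_succ]
    unfold ww
    rw [← EE_lin]
    congr 1
    ext j
    rcases lt_trichotomy j 0 with h | h | h
    · have h1 : ¬ (0 < j + 1) := by omega
      have h2 : ¬ (0 < j) := by omega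
      have h3 : ¬ (0 < j - 1) := by omega
      have h4 : j ≠ 0 := by omega
      have h5 : j ≠ 1 := by omega
      simp only [h1, h2, h3, h4, h5, if_false]; ring
    · subst h; norm_num
    · by_cases h6 : j = 1
      · subst h6; norm_num; ring
      · have h1 : (0 < j + 1) := by omega
        have h3 : (0 < j - 1) := by omega
        have h4 : j ≠ 0 := by omega
        simp only [h1, h, h3, h4, h6, if_false, if_true]; ring
  rw [h]; ring

lemma ww_der (p q : ℝ) (n : ℕ) : ∀ k : ℤ, (k : ℝ) * ww p q (n + 1) k =
    (n + 1) * (q * (1 - p) * ww p q n (k - 1) - p * (1 - q) * ww p q n (k + 1)) := by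
  induction n with
  | zero =>
    intro k
    rw [ww_succ]
    simp only [ww_zero]
    by_cases h0 : k = 0
    · subst h0; norm_num
    by_cases h1 : k = 1
    · subst h1; norm_num
    by_cases h2 : k = -1
    · subst h2; norm_num
    have h3 : k - 1 ≠ 0 := by omega
    have h4 : k + 1 ≠ 0 := by omega
    simp [h0, h3, h4]
  | succ n ih =>
    intro k
    have i1 := ih (k - 1)
    have i2 := ih k
    have i3 := ih (k + 1)
    have s1 := ww_succ p q n (k - 1)
    have s3 := ww_succ p q n (k + 1)
    rw [ww_succ p q (n + 1) k]
    simp only [sub_add_cancel, add_sub_cancel_right] at i1 i3 s1 s3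
    push_cast at *
    linear_combination (q * (1 - p)) * i1 + (p * q + (1 - p) * (1 - q)) * i2 +
      (p * (1 - q)) * i3 - (n + 1) * (q * (1 - p)) * s1 + (n + 1) * (p * (1 - q)) * s3

lemma f_lt (p q : ℝ) (hq : 0 < q) (hqp : q < p) (hp1 : p < 1) (n : ℕ)
    (hd : (2 * (n : ℝ) + 1) * (p - q) < 1 ∨ (p + q ≠ 1 ∧ (2 * (n : ℝ) + 1) * (p - q) ≤ 1)) :
    f n p q < f (n + 1) p q := by
  have ha : 0 < q * (1 - p) := mul_pos hq (by linarith)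
  have hb : 0 < p * (1 - q) := mul_pos (by linarith) (by linarith)
  have hc : 0 < p * q + (1 - p) * (1 - q) :=
    add_pos (mul_pos (by linarith) hq) (mul_pos (by linarith) (by linarith))
  have hD : (p * q + (1 - p) * (1 - q)) ^ 2 - 4 * ((q * (1 - p)) * (p * (1 - q)))
      = (p + q - 1) ^ 2 := by ring
  have key := core_final (q * (1 - p)) (p * (1 - q)) (p * q + (1 - p) * (1 - q)) ha hb hc
    (by nlinarith [sq_nonneg (p + q - 1)]) (by ring) (fun n => ww p q n 0)
    (fun n => p * (1 - q) * ww p q n 1) (by simp [ww_zero]) (by simp [ww_zero])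
    (by
      intro n
      have h := ww_der p q n 0
      have s := ww_succ p q n 0
      simp only [zero_sub, zero_add, Int.cast_zero, zero_mul] at h s
      have h' : q * (1 - p) * ww p q n (-1) - p * (1 - q) * ww p q n 1 = 0 := by
        rcases mul_eq_zero.1 h.symm with h | h
        · exact absurd h (by positivity)
        · exact h
      rw [s]; linarith)
    (by
      intro n
      have h := ww_der p q n 1
      have s := ww_succ p q n 1
      norm_num at h s
      linear_combination (p * (1 - q)) * h + (n + 1) * (p * (1 - q)) * s) n
    (by
      have e : p * (1 - q) - q * (1 - p) = p - q := by ring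
      rw [e]
      rcases hd with h | ⟨h1, h2⟩
      · exact Or.inl h
      · refine Or.inr ⟨?_, h2⟩
        have : 0 < (p + q - 1) ^ 2 := by
          have : p + q - 1 ≠ 0 := sub_ne_zero.2 h1
          positivity
        linarith)
  have := f_succ n p q
  linarith

theorem statement8 (p q : ℝ) (hq : 0 < q) (hqp : q < p) (hp1 : p < 1) (n : ℕ)
    (hmax : ∀ m : ℕ, f m p q ≤ f n p q) :
    ⌊1 / (2 * (p - q)) - 1 / 2⌋ ≤ (n : ℤ) ∧
      (p + q ≠ 1 → ⌊1 / (2 * (p - q)) + 1 / 2⌋ ≤ (n : ℤ)) := by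
  have hd : 0 < p - q := sub_pos.2 hqp
  have hm : 1 / (2 * (p - q)) * (p - q) = 1 / 2 := by field_simp
  constructor
  · by_contra h
    have h1 : (n : ℤ) + 1 ≤ ⌊1 / (2 * (p - q)) - 1 / 2⌋ := by omega
    rw [Int.le_floor] at h1
    push_cast at h1
    have h2 := mul_le_mul_of_nonneg_right h1 hd.le
    have := f_lt p q hq hqp hp1 n (Or.inl (by nlinarith))
    exact absurd (hmax (n + 1)) (not_le.2 this)
  · intro hpq
    by_contra h
    have h1 : (n : ℤ) + 1 ≤ ⌊1 / (2 * (p - q)) + 1 / 2⌋ := by omega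
    rw [Int.le_floor] at h1
    push_cast at h1
    have h2 := mul_le_mul_of_nonneg_right h1 hd.le
    have := f_lt p q hq hqp hp1 n (Or.inr ⟨hpq, by nlinarith⟩)
    exact absurd (hmax (n + 1)) (not_le.2 this)
end

section
/- (Endpoint signs) For every integer n ≥ 1 and every real q with 0 < q < n/(2n+1), one has J_n(q, q) > 0 and J_n(q, 1−q) < 0. -/
noncomputable def phi (n : ℕ) (z : ℝ) : ℝ :=
  ∑ r ∈ Finset.range (n + 1), (n.choose r : ℝ) ^ 2 * z ^ r
/-- `psi n z = Σ_{r=0}^{n-1} C(n,r+1) C(n,r) z^(r+1)`. -/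
noncomputable def psi (n : ℕ) (z : ℝ) : ℝ :=
  ∑ r ∈ Finset.range n, (n.choose (r + 1) : ℝ) * (n.choose r : ℝ) * z ^ (r + 1)
/-- The indicator function `J n q p = (q/(1−q)) φ_n(z) − ψ_n(z)` with
`z = pq/((1−p)(1−q))`. -/
noncomputable def J (n : ℕ) (q p : ℝ) : ℝ :=
  (q / (1 - q)) * phi n (p * q / ((1 - p) * (1 - q))) -
    psi n (p * q / ((1 - p) * (1 - q)))

theorem aux_amgm (a : ℕ → ℝ) (n : ℕ) :
    2 * ∑ r ∈ Finset.range n, a r * a (r + 1) + a 0 ^ 2 + a n ^ 2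
      ≤ 2 * ∑ r ∈ Finset.range (n + 1), a r ^ 2 := by
  induction n with
  | zero => simp; linarith
  | succ k ih =>
    rw [Finset.sum_range_succ, Finset.sum_range_succ _ (k + 1)]
    nlinarith [sq_nonneg (a k - a (k + 1))]

theorem phi_one (n : ℕ) : phi n 1 = ((2 * n).choose n : ℝ) := by
  unfold phi
  rw [← Nat.sum_range_choose_sq]
  push_cast
  simp

theorem psi_one (n : ℕ) : psi n 1 = ((2 * n).choose (n + 1) : ℝ) := by
  unfold psi
  rw [two_mul, Nat.add_choose_eq, Finset.Nat.sum_antidiagonal_eq_sum_range_succ_mk,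
    Finset.sum_range_succ', Finset.sum_range_succ]
  simp only [one_pow, mul_one, Nat.choose_succ_self, zero_mul, add_zero, Nat.sub_zero, mul_zero]
  push_cast
  apply Finset.sum_congr rfl
  intro r hr
  rw [Finset.mem_range] at hr
  rw [Nat.choose_symm hr.le]

theorem statement15 (n : ℕ) (hn : 1 ≤ n) (q : ℝ) (hq : 0 < q)
    (hq2 : q < (n : ℝ) / (2 * n + 1)) :
    0 < J n q q ∧ J n q (1 - q) < 0 := by
  have hn' : (1:ℝ) ≤ n := by exact_mod_cast hn
  rw [lt_div_iff₀ (by positivity)] at hq2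
  have h1 : 0 < 1 - q := by nlinarith
  have ht : 0 < q / (1 - q) := by positivity
  constructor
  · unfold J
    have hz : q * q / ((1 - q) * (1 - q)) = (q / (1 - q)) ^ 2 := by
      rw [div_pow, sq, sq]
    rw [hz]
    generalize q / (1 - q) = t at ht
    have h := aux_amgm (fun r => (n.choose r : ℝ) * t ^ r) n
    have e1 : phi n (t ^ 2) = ∑ r ∈ Finset.range (n + 1), ((n.choose r : ℝ) * t ^ r) ^ 2 := by
      unfold phi
      apply Finset.sum_congr rfl
      intro r _
      ring
    have e2 : psi n (t ^ 2) = t * ∑ r ∈ Finset.range n,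
        ((n.choose r : ℝ) * t ^ r) * ((n.choose (r + 1) : ℝ) * t ^ (r + 1)) := by
      unfold psi
      rw [Finset.mul_sum]
      apply Finset.sum_congr rfl
      intro r _
      ring
    rw [e1, e2, ← mul_sub]
    apply mul_pos ht
    simp only [Nat.choose_zero_right, pow_zero, Nat.cast_one, mul_one, one_pow] at h
    nlinarith [sq_nonneg ((n.choose n : ℝ) * t ^ n)]
  · unfold J
    have hz : (1 - q) * q / ((1 - (1 - q)) * (1 - q)) = 1 := by
      rw [sub_sub_cancel, mul_comm]
      exact div_self (by positivity)
    rw [hz, phi_one, psi_one]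
    have hc := Nat.choose_succ_right_eq (2 * n) n
    rw [show 2 * n - n = n by omega] at hc
    have hc' : ((2 * n).choose (n + 1) : ℝ) * (n + 1) = (2 * n).choose n * n := by
      exact_mod_cast hc
    have hp : (0:ℝ) < (2 * n).choose n := by
      exact_mod_cast Nat.choose_pos (by omega)
    have e : ((2 * n).choose (n + 1) : ℝ) = n / (n + 1) * (2 * n).choose n := by
      field_simp
      linarith
    rw [e, ← sub_mul]
    apply mul_neg_of_neg_of_pos _ hp
    rw [sub_neg, div_lt_div_iff₀ h1 (by positivity)]
    nlinarith
end

section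
/- (The nullcline lies below the line M_n) For every integer n ≥ 1 and every real q with 0 < q < n/(2n+1), with p = 1/(n+1) + (n/(n+1))·q one has J_n(q, p) < 0; equivalently, f(n+1, p, q) < f(n, p, q) at this p. -/
theorem aux_ch (n r : ℕ) (hr : r ≤ n) :
    ((r : ℝ) + 1) * (n.choose (r + 1) : ℝ) = ((n : ℝ) - r) * (n.choose r : ℝ) := by
  have h := Nat.choose_succ_right_eq n r
  have h2 : ((n.choose (r + 1) * (r + 1) : ℕ) : ℝ) = ((n.choose r * (n - r) : ℕ) : ℝ) := by
    rw [h]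
  push_cast [Nat.cast_sub hr] at h2
  linarith

noncomputable def auxT (n : ℕ) (z : ℝ) : ℝ :=
  ∑ r ∈ Finset.range (n + 1), (n.choose r : ℝ) * (n.choose (r + 1) : ℝ) * z ^ r
noncomputable def auxC (n : ℕ) (z : ℝ) : ℝ :=
  ∑ r ∈ Finset.range (n + 1), (r : ℝ) * ((n.choose r : ℝ) * (n.choose (r + 1) : ℝ) * z ^ r)
noncomputable def auxA (n : ℕ) (z : ℝ) : ℝ :=
  ∑ r ∈ Finset.range (n + 1), (r : ℝ) * ((n.choose r : ℝ) ^ 2 * z ^ r)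

theorem aux_psi (n : ℕ) (z : ℝ) : psi n z = z * auxT n z := by
  unfold psi auxT
  rw [Finset.sum_range_succ, Nat.choose_succ_self, mul_add, Finset.mul_sum]
  simp only [Nat.cast_zero, mul_zero, zero_mul, add_zero]
  exact Finset.sum_congr rfl fun r _ => by ring

theorem aux_A1 (n : ℕ) (z : ℝ) : auxA n z = z * (n * auxT n z - auxC n z) := by
  have h : auxA n z = ∑ r ∈ Finset.range (n + 1),
      ((r + 1 : ℕ) : ℝ) * ((n.choose (r + 1) : ℝ) ^ 2 * z ^ (r + 1)) := by
    rw [Finset.sum_range_succ, Nat.choose_succ_self]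
    unfold auxA
    rw [Finset.sum_range_succ']
    simp
  rw [h]
  unfold auxT auxC
  rw [Finset.mul_sum, ← Finset.sum_sub_distrib, Finset.mul_sum]
  refine Finset.sum_congr rfl fun r hr => ?_
  have := aux_ch n r (by simpa [Nat.lt_succ_iff] using hr)
  push_cast
  linear_combination (n.choose (r + 1) : ℝ) * z ^ (r + 1) * this

theorem aux_A2 (n : ℕ) (z : ℝ) : n * phi n z - auxA n z = auxT n z + auxC n z := by
  unfold phi auxA auxT auxC
  rw [Finset.mul_sum, ← Finset.sum_sub_distrib, ← Finset.sum_add_distrib]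
  refine Finset.sum_congr rfl fun r hr => ?_
  have := aux_ch n r (by simpa [Nat.lt_succ_iff] using hr)
  linear_combination -(n.choose r : ℝ) * z ^ r * this

theorem aux_pos (n : ℕ) (hn : 1 ≤ n) (z : ℝ) (hz : 0 < z) :
    0 < auxT n z * auxA n z - auxC n z * phi n z := by
  have e : auxT n z * auxA n z - auxC n z * phi n z =
      ∑ r ∈ Finset.range (n + 1), ∑ s ∈ Finset.range (n + 1),
        (n.choose r : ℝ) * (n.choose (r + 1) : ℝ) * (n.choose s : ℝ) ^ 2 * ((s : ℝ) - r)
          * (z ^ r * z ^ s) := by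
    unfold phi auxA auxT auxC
    rw [Finset.sum_mul_sum, Finset.sum_mul_sum, ← Finset.sum_sub_distrib]
    refine Finset.sum_congr rfl fun r hr => ?_
    rw [← Finset.sum_sub_distrib]
    exact Finset.sum_congr rfl fun s hs => by ring
  have e2 : 2 * (auxT n z * auxA n z - auxC n z * phi n z) =
      ∑ r ∈ Finset.range (n + 1), ∑ s ∈ Finset.range (n + 1),
        (n.choose r : ℝ) ^ 2 * (n.choose s : ℝ) ^ 2 * ((s : ℝ) - r) ^ 2 * (n + 1)
          / ((r + 1) * (s + 1)) * (z ^ r * z ^ s) := by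
    rw [two_mul]
    nth_rewrite 2 [e]
    rw [Finset.sum_comm, e, ← Finset.sum_add_distrib]
    refine Finset.sum_congr rfl fun r hr => ?_
    rw [← Finset.sum_add_distrib]
    refine Finset.sum_congr rfl fun s hs => ?_
    have h1 := aux_ch n r (by simpa [Nat.lt_succ_iff] using hr)
    have h2 := aux_ch n s (by simpa [Nat.lt_succ_iff] using hs)
    have hr0 : (r : ℝ) + 1 ≠ 0 := by positivity
    have hs0 : (s : ℝ) + 1 ≠ 0 := by positivity
    have h1' : (n.choose (r + 1) : ℝ) = ((n : ℝ) - r) * (n.choose r : ℝ) / (r + 1) := by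
      field_simp; linarith
    have h2' : (n.choose (s + 1) : ℝ) = ((n : ℝ) - s) * (n.choose s : ℝ) / (s + 1) := by
      field_simp; linarith
    rw [h1', h2']
    field_simp
    ring
  have h3 : 0 < 2 * (auxT n z * auxA n z - auxC n z * phi n z) := by
    rw [e2]
    refine Finset.sum_pos' (fun r _ => Finset.sum_nonneg fun s _ => by positivity)
      ⟨0, by simp, ?_⟩
    refine Finset.sum_pos' (fun s _ => by positivity) ⟨1, by simp; omega, ?_⟩
    have : (0 : ℝ) < n := by exact_mod_cast hn
    simp
    positivity
  linarith

theorem aux_key (n : ℕ) (hn : 1 ≤ n) (z : ℝ) (hz : 0 < z) (hz1 : z < 1) :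
    n * phi n z ^ 2 < auxT n z * phi n z + (n + 1) * z * auxT n z ^ 2 := by
  have h := mul_pos (sub_pos.2 hz1) (aux_pos n hn z hz)
  have h1 := aux_A1 n z
  have h2 := aux_A2 n z
  have hC : auxC n z = n * phi n z - auxA n z - auxT n z := by linarith
  have hA : (1 - z) * auxA n z = z * ((n + 1) * auxT n z - n * phi n z) := by
    rw [hC] at h1; linarith
  rw [hC] at h
  have : (1 - z) * (auxT n z * auxA n z - (n * phi n z - auxA n z - auxT n z) * phi n z)
      = auxT n z * phi n z + (n + 1) * z * auxT n z ^ 2 - n * phi n z ^ 2 := by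
    linear_combination (auxT n z + phi n z) * hA
  linarith

theorem aux_x (n : ℕ) (hn : 1 ≤ n) (z x : ℝ) (hz : 0 < z) (hz1 : z < 1) (hx : 0 < x)
    (hxz : n * z = x + (n + 1) * x ^ 2) : x * phi n z < psi n z := by
  have hk := aux_key n hn z hz hz1
  have hphi : 0 < phi n z := by
    unfold phi
    exact Finset.sum_pos' (fun r _ => by positivity) ⟨0, by simp, by simp⟩
  have hT : 0 ≤ auxT n z := Finset.sum_nonneg fun r _ => by positivity
  rw [aux_psi]
  by_contra hc
  push Not at hc
  have h0 : 0 ≤ z * auxT n z := by positivity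
  have h1 := mul_pos hz (sub_pos.2 hk)
  have h2 : 0 ≤ (x * phi n z - z * auxT n z) * ((n + 1) * (x * phi n z + z * auxT n z) + phi n z) :=
    mul_nonneg (sub_nonneg.2 hc) (by positivity)
  have h3 : n * z * phi n z ^ 2 = (x + (n + 1) * x ^ 2) * phi n z ^ 2 := by rw [hxz]
  nlinarith

noncomputable def auxb (n : ℕ) (p : ℝ) (r : ℕ) : ℝ :=
  (n.choose r : ℝ) * p ^ r * (1 - p) ^ (n - r)

theorem auxb_top (n : ℕ) (p : ℝ) : auxb n p (n + 1) = 0 := by simp [auxb]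

theorem auxb_succ (n : ℕ) (p : ℝ) (r : ℕ) (hr : r ≤ n) :
    auxb (n + 1) p (r + 1) = p * auxb n p r + (1 - p) * auxb n p (r + 1) := by
  unfold auxb
  rw [Nat.choose_succ_succ, Nat.add_sub_add_right]
  rcases hr.eq_or_lt with h | h
  · subst h; simp; ring
  · obtain ⟨k, rfl⟩ : ∃ k, n = r + 1 + k := ⟨n - (r + 1), by omega⟩
    rw [show r + 1 + k - r = k + 1 by omega, show r + 1 + k - (r + 1) = k by omega]
    push_cast
    ring

noncomputable def auxG (n : ℕ) (q : ℝ) (r : ℕ) : ℝ := ∑ s ∈ Finset.Icc (r + 1) n, auxb n q s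

theorem auxG_top (n : ℕ) (q : ℝ) (r : ℕ) (h : n ≤ r) : auxG n q r = 0 := by
  unfold auxG
  rw [Finset.Icc_eq_empty (by omega), Finset.sum_empty]

theorem auxG_step (n : ℕ) (q : ℝ) (r : ℕ) (hr : r ≤ n) :
    auxG n q r = auxb n q (r + 1) + auxG n q (r + 1) := by
  rcases hr.eq_or_lt with h | h
  · subst h; rw [auxG_top _ _ _ le_rfl, auxG_top _ _ _ (Nat.le_succ _), auxb_top]; simp
  · unfold auxG
    rw [← Finset.add_sum_Ioc_eq_sum_Icc (by omega : r + 1 ≤ n)]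
    have : Finset.Ioc (r + 1) n = Finset.Icc (r + 1 + 1) n := by
      ext x; simp only [Finset.mem_Ioc, Finset.mem_Icc]; omega
    rw [this]

theorem auxG_succ (n : ℕ) (q : ℝ) (k : ℕ) : ∀ r, r + k = n + 1 →
    auxG (n + 1) q r = auxG n q r + q * auxb n q r := by
  induction k with
  | zero =>
    intro r hr
    have : r = n + 1 := by omega
    subst this
    rw [auxG_top _ _ _ le_rfl, auxG_top _ _ _ (Nat.le_succ _), auxb_top]; simp
  | succ k ih =>
    intro r hr
    rw [auxG_step (n + 1) q r (by omega), ih (r + 1) (by omega), auxb_succ n q r (by omega),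
      auxG_step n q r (by omega)]
    ring

theorem auxb_sum (n : ℕ) (p : ℝ) (h : ℕ → ℝ) :
    ∑ r ∈ Finset.range (n + 1 + 1), auxb (n + 1) p r * h r =
      ∑ r ∈ Finset.range (n + 1), auxb n p r * ((1 - p) * h r + p * h (r + 1)) := by
  have h0 : auxb (n + 1) p 0 = (1 - p) * auxb n p 0 := by simp [auxb, pow_succ']
  have h1 : ∑ r ∈ Finset.range (n + 1), auxb n p (r + 1) * h (r + 1) + auxb n p 0 * h 0
      = ∑ r ∈ Finset.range (n + 1), auxb n p r * h r := by
    rw [← Finset.sum_range_succ' (fun r => auxb n p r * h r), Finset.sum_range_succ, auxb_top]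
    simp
  have h2 : ∑ r ∈ Finset.range (n + 1), auxb n p r * ((1 - p) * h r + p * h (r + 1))
      = (1 - p) * ∑ r ∈ Finset.range (n + 1), auxb n p r * h r
        + p * ∑ r ∈ Finset.range (n + 1), auxb n p r * h (r + 1) := by
    rw [Finset.mul_sum, Finset.mul_sum, ← Finset.sum_add_distrib]
    exact Finset.sum_congr rfl fun r _ => by ring
  have h3 : ∑ r ∈ Finset.range (n + 1), auxb (n + 1) p (r + 1) * h (r + 1)
      = p * ∑ r ∈ Finset.range (n + 1), auxb n p r * h (r + 1)
        + (1 - p) * ∑ r ∈ Finset.range (n + 1), auxb n p (r + 1) * h (r + 1) := by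
    rw [Finset.mul_sum, Finset.mul_sum, ← Finset.sum_add_distrib]
    refine Finset.sum_congr rfl fun r hr => ?_
    rw [auxb_succ n p r (by simpa [Nat.lt_succ_iff] using hr)]
    ring
  rw [Finset.sum_range_succ', h3, h2, h0, ← h1]
  ring

theorem aux_f (n : ℕ) (p q : ℝ) :
    f n p q = ∑ r ∈ Finset.range (n + 1), auxb n p r * auxG n q r := by
  unfold f auxG auxb
  exact Finset.sum_congr rfl fun r _ => by rw [Finset.mul_sum]

theorem aux_fdiff (n : ℕ) (p q : ℝ) :
    f (n + 1) p q - f n p q = ∑ r ∈ Finset.range (n + 1),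
      auxb n p r * ((1 - p) * q * auxb n q r - p * (1 - q) * auxb n q (r + 1)) := by
  rw [aux_f, aux_f, auxb_sum, ← Finset.sum_sub_distrib]
  refine Finset.sum_congr rfl fun r hr => ?_
  have hr' : r ≤ n := by simpa [Nat.lt_succ_iff] using hr
  rw [auxG_succ n q (n + 1 - r) r (by omega), auxG_succ n q (n - r) (r + 1) (by omega),
    auxG_step n q r hr']
  ring

theorem aux_fJ (n : ℕ) (p q : ℝ) (hp : 1 - p ≠ 0) (hq : 1 - q ≠ 0) :
    f (n + 1) p q - f n p q = ((1 - p) * (1 - q)) ^ (n + 1) * J n q p := by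
  rw [aux_fdiff]
  unfold J
  rw [aux_psi]
  unfold phi auxT
  rw [Finset.mul_sum, Finset.mul_sum, ← Finset.sum_sub_distrib, Finset.mul_sum]
  refine Finset.sum_congr rfl fun r hr => ?_
  have hr' : r ≤ n := by simpa [Nat.lt_succ_iff] using hr
  unfold auxb
  generalize 1 - p = a at *
  generalize 1 - q = b at *
  rcases hr'.eq_or_lt with h | h
  · subst h
    simp only [Nat.choose_succ_self, Nat.choose_self, Nat.sub_self, div_pow, mul_pow]
    simp
    field_simp
    ring
  · obtain ⟨k, rfl⟩ : ∃ k, n = r + 1 + k := ⟨n - (r + 1), by omega⟩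
    rw [show r + 1 + k - r = k + 1 by omega, show r + 1 + k - (r + 1) = k by omega]
    simp only [div_pow, mul_pow]
    field_simp
    try ring

theorem statement16 (n : ℕ) (hn : 1 ≤ n) (q : ℝ) (hq : 0 < q)
    (hq2 : q < (n : ℝ) / (2 * n + 1)) (p : ℝ)
    (hp : p = 1 / (n + 1) + ((n : ℝ) / (n + 1)) * q) :
    J n q p < 0 ∧ f (n + 1) p q < f n p q := by
  have hn0 : (0 : ℝ) < n := by exact_mod_cast hn
  have hq3 : q * (2 * n + 1) < n := by rwa [lt_div_iff₀ (by positivity)] at hq2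
  have hq1 : 0 < 1 - q := by nlinarith
  have h1p : 1 - p = n * (1 - q) / (n + 1) := by rw [hp]; field_simp; ring
  have hp' : p = (1 + n * q) / (n + 1) := by rw [hp]; field_simp
  have hp1 : 0 < 1 - p := by rw [h1p]; positivity
  have hp0 : 0 < p := by rw [hp']; positivity
  have hJ : J n q p < 0 := by
    unfold J
    have := aux_x n hn (p * q / ((1 - p) * (1 - q))) (q / (1 - q)) (by positivity)
      (by
        rw [div_lt_one (by positivity)]
        have : p + q < 1 := by
          rw [hp', ← sub_pos]
          have : 1 - ((1 + n * q) / (n + 1) + q) = (n - q * (2 * n + 1)) / (n + 1) := by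
            field_simp; ring
          rw [this]
          exact div_pos (by linarith) (by positivity)
        nlinarith)
      (by positivity)
      (by
        rw [h1p, hp']
        field_simp
        ring)
    linarith
  refine ⟨hJ, ?_⟩
  have h := aux_fJ n p q hp1.ne' hq1.ne'
  have : ((1 - p) * (1 - q)) ^ (n + 1) * J n q p < 0 :=
    mul_neg_of_pos_of_neg (by positivity) hJ
  linarith
end
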